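/- Let fₖ, f : (−1,1)² → ℝ² satisfy: fₖ(x,y) → f(x,y) for every (x,y) ∈ (−1,1)²; for every k and almost every y ∈ (−1,1) the horizontal restrictions x ↦ fₖ(x,y) and x ↦ f(x,y) have bounded variation on (−1,1), and for almost every x ∈ (−1,1) the vertical restrictions y ↦ fₖ(x,y) and y ↦ f(x,y) have bounded variation on (−1,1); the functions Vₖ(y) := Var(fₖ(·,y), (−1,1)), V(y) := Var(f(·,y), (−1,1)), Hₖ(x) := Var(fₖ(x,·), (−1,1)), H(x) := Var(f(x,·), (−1,1)) are Lebesgue measurable; and ∫₋₁¹ Vₖ(y) dy + ∫₋₁¹ Hₖ(x) dx → ∫₋₁¹ V(y) dy + ∫₋₁¹ H(x) dx < ∞ as k → ∞. Then there exist a subsequence (k_j) and a Lebesgue-null set N ⊂ (−1,1) such that for every t ∈ (−1,1) \ N one has Var(f_{k_j}(·,t), (−1,1)) → Var(f(·,t), (−1,1)) and Var(f_{k_j}(t,·), (−1,1)) → Var(f(t,·), (−1,1)) as j → ∞. -/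

import Mathlib

open Set Filter MeasureTheory

lemma aux_min {a : ℕ → ENNReal} {V : ENNReal} (h : ∀ v < V, ∀ᶠ k in atTop, v < a k) :
    Tendsto (fun k => min (a k) V) atTop (nhds V) := by
  rw [tendsto_order]
  refine ⟨fun v hv => ?_, fun v hv => ?_⟩
  · filter_upwards [h v hv] with k hk using lt_min hk hv
  · exact Eventually.of_forall fun k => lt_of_le_of_lt (min_le_right _ _) hv

lemma aux_pt {a b e : ℕ → ENNReal} {V H : ENNReal} (hH : H ≠ ⊤) (hV : V ≠ ⊤)
    (ha : Tendsto (fun k => min (a k) V) atTop (nhds V))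
    (hb : Tendsto (fun k => min (b k) H) atTop (nhds H))
    (he : Tendsto e atTop (nhds 0)) (hle : ∀ k, a k + b k ≤ V + H + e k) :
    Tendsto a atTop (nhds V) := by
  have h1 : Tendsto (fun k => V + H + e k - min (b k) H) atTop (nhds (V + H + 0 - H)) :=
    ENNReal.Tendsto.sub (tendsto_const_nhds.add he) hb (Or.inr hH)
  have h2 : V + H + 0 - H = V := by
    rw [add_zero]; exact ENNReal.add_sub_cancel_right hH
  rw [h2] at h1
  refine tendsto_of_tendsto_of_tendsto_of_le_of_le ha h1 (fun k => min_le_left _ _) (fun k => ?_)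
  refine ENNReal.le_sub_of_add_le_right ?_ ?_
  · exact ne_top_of_le_ne_top hH (min_le_right _ _)
  · exact le_trans (by gcongr; exact min_le_left _ _) (hle k)

lemma aux_meas {μ : Measure ℝ} {W : ℕ → ℝ → ENNReal} {U : ℝ → ENNReal}
    (hW : ∀ k, Measurable (W k)) (hU : Measurable U) (hfin : ∫⁻ t, U t ∂μ ≠ ⊤)
    (hmin : ∀ᵐ t ∂μ, Tendsto (fun k => min (W k t) (U t)) atTop (nhds (U t)))
    (hconv : Tendsto (fun k => ∫⁻ t, W k t ∂μ) atTop (nhds (∫⁻ t, U t ∂μ))) :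
    ∃ φ : ℕ → ℕ, StrictMono φ ∧
      ∀ᵐ t ∂μ, Tendsto (fun j => W (φ j) t - U t) atTop (nhds 0) := by
  have hm : Tendsto (fun k => ∫⁻ t, min (W k t) (U t) ∂μ) atTop (nhds (∫⁻ t, U t ∂μ)) :=
    tendsto_lintegral_of_dominated_convergence U (fun k => (hW k).min hU)
      (fun k => Eventually.of_forall fun t => min_le_right _ _) hfin hmin
  have he : Tendsto (fun k => ∫⁻ t, (W k t - U t) ∂μ) atTop (nhds 0) := by
    have h1 := ENNReal.Tendsto.sub hconv hm (Or.inr hfin)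
    rw [tsub_self] at h1
    refine h1.congr fun k => ?_
    rw [← lintegral_sub ((hW k).min hU)]
    · refine lintegral_congr fun t => ?_
      rcases le_total (W k t) (U t) with h | h
      · simp [h, tsub_eq_zero_of_le h]
      · simp [h]
    · exact ne_top_of_le_ne_top hfin (lintegral_mono fun t => min_le_right _ _)
    · exact Eventually.of_forall fun t => min_le_left _ _
  have hev : ∀ n : ℕ, ∀ᶠ k in atTop, ∫⁻ t, (W k t - U t) ∂μ < (2⁻¹ : ENNReal) ^ n := fun n =>
    he.eventually (gt_mem_nhds (by simp [ENNReal.pow_pos]))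
  obtain ⟨φ, hφ, hφ'⟩ := extraction_forall_of_eventually hev
  refine ⟨φ, hφ, ?_⟩
  have hmeas : ∀ j, Measurable fun t => W (φ j) t - U t := fun j => (hW _).sub hU
  have hsum : ∫⁻ t, ∑' j, (W (φ j) t - U t) ∂μ ≠ ⊤ := by
    rw [lintegral_tsum fun j => (hmeas j).aemeasurable]
    refine ne_top_of_le_ne_top ?_ (ENNReal.tsum_le_tsum fun j => (hφ' j).le)
    rw [ENNReal.tsum_geometric]
    simp
  filter_upwards [ae_lt_top (Measurable.tsum hmeas) hsum] with t ht
  exact ENNReal.tendsto_atTop_zero_of_tsum_ne_top ht.ne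

/-- Manhattan-strict convergence of planar BV maps yields, along a
subsequence, strict convergence of the variations on almost every horizontal and
vertical line. -/
theorem stmt_3
    (f : ℕ → ℝ × ℝ → EuclideanSpace ℝ (Fin 2)) (g : ℝ × ℝ → EuclideanSpace ℝ (Fin 2))
    (hpt : ∀ p ∈ Set.Ioo (-1 : ℝ) 1 ×ˢ Set.Ioo (-1 : ℝ) 1,
      Filter.Tendsto (fun k => f k p) Filter.atTop (nhds (g p)))
    (hBVh : ∀ k, ∀ᵐ y ∂(volume.restrict (Set.Ioo (-1 : ℝ) 1)),
      eVariationOn (fun x => f k (x, y)) (Set.Ioo (-1 : ℝ) 1) ≠ ⊤ ∧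
      eVariationOn (fun x => g (x, y)) (Set.Ioo (-1 : ℝ) 1) ≠ ⊤)
    (hBVv : ∀ k, ∀ᵐ x ∂(volume.restrict (Set.Ioo (-1 : ℝ) 1)),
      eVariationOn (fun y => f k (x, y)) (Set.Ioo (-1 : ℝ) 1) ≠ ⊤ ∧
      eVariationOn (fun y => g (x, y)) (Set.Ioo (-1 : ℝ) 1) ≠ ⊤)
    (hVmeas : ∀ k, Measurable
      (fun y => eVariationOn (fun x => f k (x, y)) (Set.Ioo (-1 : ℝ) 1)))
    (hVmeas' : Measurable
      (fun y => eVariationOn (fun x => g (x, y)) (Set.Ioo (-1 : ℝ) 1)))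
    (hHmeas : ∀ k, Measurable
      (fun x => eVariationOn (fun y => f k (x, y)) (Set.Ioo (-1 : ℝ) 1)))
    (hHmeas' : Measurable
      (fun x => eVariationOn (fun y => g (x, y)) (Set.Ioo (-1 : ℝ) 1)))
    (hfin : (∫⁻ y in Set.Ioo (-1 : ℝ) 1,
        eVariationOn (fun x => g (x, y)) (Set.Ioo (-1 : ℝ) 1))
      + (∫⁻ x in Set.Ioo (-1 : ℝ) 1,
        eVariationOn (fun y => g (x, y)) (Set.Ioo (-1 : ℝ) 1)) ≠ ⊤)
    (hconv : Filter.Tendsto (fun k =>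
        (∫⁻ y in Set.Ioo (-1 : ℝ) 1,
          eVariationOn (fun x => f k (x, y)) (Set.Ioo (-1 : ℝ) 1))
        + (∫⁻ x in Set.Ioo (-1 : ℝ) 1,
          eVariationOn (fun y => f k (x, y)) (Set.Ioo (-1 : ℝ) 1)))
      Filter.atTop
      (nhds ((∫⁻ y in Set.Ioo (-1 : ℝ) 1,
          eVariationOn (fun x => g (x, y)) (Set.Ioo (-1 : ℝ) 1))
        + (∫⁻ x in Set.Ioo (-1 : ℝ) 1,
          eVariationOn (fun y => g (x, y)) (Set.Ioo (-1 : ℝ) 1))))) :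
    ∃ φ : ℕ → ℕ, StrictMono φ ∧
      ∃ N ⊆ Set.Ioo (-1 : ℝ) 1, volume N = 0 ∧
        ∀ t ∈ Set.Ioo (-1 : ℝ) 1 \ N,
          Filter.Tendsto
            (fun j => eVariationOn (fun x => f (φ j) (x, t)) (Set.Ioo (-1 : ℝ) 1))
            Filter.atTop
            (nhds (eVariationOn (fun x => g (x, t)) (Set.Ioo (-1 : ℝ) 1))) ∧
          Filter.Tendsto
            (fun j => eVariationOn (fun y => f (φ j) (t, y)) (Set.Ioo (-1 : ℝ) 1))
            Filter.atTop
            (nhds (eVariationOn (fun y => g (t, y)) (Set.Ioo (-1 : ℝ) 1))) := by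
  set I := Set.Ioo (-1 : ℝ) 1 with hI
  set V : ℕ → ℝ → ENNReal := fun k y => eVariationOn (fun x => f k (x, y)) I with hVd
  set V' : ℝ → ENNReal := fun y => eVariationOn (fun x => g (x, y)) I with hVd'
  set H : ℕ → ℝ → ENNReal := fun k x => eVariationOn (fun y => f k (x, y)) I with hHd
  set H' : ℝ → ENNReal := fun x => eVariationOn (fun y => g (x, y)) I with hHd'
  have hV : ∀ t ∈ I, ∀ v < V' t, ∀ᶠ k in atTop, v < V k t := fun t ht v hv =>
    eVariationOn.lowerSemicontinuous_aux (fun x hx => hpt (x, t) ⟨hx, ht⟩) hv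
  have hH : ∀ t ∈ I, ∀ v < H' t, ∀ᶠ k in atTop, v < H k t := fun t ht v hv =>
    eVariationOn.lowerSemicontinuous_aux (fun x hx => hpt (t, x) ⟨ht, hx⟩) hv
  have hVm := fun t ht => aux_min (hV t ht)
  have hHm := fun t ht => aux_min (hH t ht)
  have hmin : ∀ t ∈ I, Tendsto (fun k => min (V k t + H k t) (V' t + H' t)) atTop
      (nhds (V' t + H' t)) := by
    intro t ht
    refine tendsto_of_tendsto_of_tendsto_of_le_of_le ((hVm t ht).add (hHm t ht))
      tendsto_const_nhds (fun k => ?_) (fun k => min_le_right _ _)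
    exact le_min (add_le_add (min_le_left _ _) (min_le_left _ _))
      (add_le_add (min_le_right _ _) (min_le_right _ _))
  have hfin' : ∫⁻ t in I, (V' t + H' t) ≠ ⊤ := by
    rw [lintegral_add_left hVmeas']; exact hfin
  obtain ⟨φ, hφ, hae⟩ := aux_meas (μ := volume.restrict I) (W := fun k t => V k t + H k t)
    (U := fun t => V' t + H' t) (fun k => (hVmeas k).add (hHmeas k)) (hVmeas'.add hHmeas')
    hfin' ((ae_restrict_iff' measurableSet_Ioo).2 (Eventually.of_forall hmin)) (by
      rw [lintegral_add_left hVmeas']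
      refine hconv.congr fun k => ?_
      rw [lintegral_add_left (hVmeas k)])
  have hall : ∀ᵐ t ∂(volume : Measure ℝ), t ∈ I →
      (Tendsto (fun j => V (φ j) t) atTop (nhds (V' t)) ∧
        Tendsto (fun j => H (φ j) t) atTop (nhds (H' t))) := by
    have h0 := (hae.and ((hBVh 0).and (hBVv 0)))
    rw [ae_restrict_iff' measurableSet_Ioo] at h0
    filter_upwards [h0] with t h ht
    obtain ⟨h1, h2, h3⟩ := h ht
    have a := (hVm t ht).comp hφ.tendsto_atTop
    have b := (hHm t ht).comp hφ.tendsto_atTop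
    refine ⟨aux_pt h3.2 h2.2 a b h1 fun k => le_add_tsub, aux_pt h2.2 h3.2 b a h1 fun k => ?_⟩
    rw [add_comm (H _ _), add_comm (H' _)]
    exact le_add_tsub
  refine ⟨φ, hφ, {t | t ∈ I ∧ ¬ (Tendsto (fun j => V (φ j) t) atTop (nhds (V' t)) ∧
        Tendsto (fun j => H (φ j) t) atTop (nhds (H' t)))}, fun t ht => ht.1, ?_, ?_⟩
  · rw [ae_iff] at hall
    simpa only [Classical.not_imp] using hall
  · rintro t ⟨ht, hn⟩
    by_contra hc
    exact hn ⟨ht, hc⟩
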